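/- (Theorem 2: eliminating the flow conservation constraint from the minimum cost flow problem) Consider a connected oriented graph on n nodes (n ≥ 2) and m arcs with oriented incidence matrix 𝔍, set μ = m − n + 1, and let B be a real μ×m matrix with 𝔍·Bᵀ = 0 and rank B = μ. Let f ∈ ℝ^n, let xₚ ∈ ℝ^m satisfy 𝔍·xₚ = f, let φ_j : ℝ → ℝ for each arc j, and let 𝖻, 𝖼 ∈ ℝ^m be capacity bounds. Then x⋆ ∈ ℝ^m is a minimizer of x ↦ Σ_{j=1}^{m} φ_j(x_j) over the feasible set {x ∈ ℝ^m | 𝔍·x = f and 𝖻_j ≤ x_j ≤ 𝖼_j for all j} if and only if there exists z⋆ ∈ ℝ^μ with x⋆ = Bᵀ·z⋆ + xₚ and z⋆ a minimizer of z ↦ Σ_{j=1}^{m} φ_j((Bᵀ·z)_j + (xₚ)_j) over the reduced feasible set {z ∈ ℝ^μ | 𝖻_j ≤ (Bᵀ·z)_j + (xₚ)_j ≤ 𝖼_j for all j}. -/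

import Mathlib

/-- The oriented incidence matrix of an oriented graph given by `tail, head`. -/
def incMat (n m : ℕ) (tail head : Fin m → Fin n) : Matrix (Fin n) (Fin m) ℝ :=
  Matrix.of fun i j => if i = tail j then 1 else if i = head j then -1 else 0

/-- The oriented graph is connected: every pair of nodes is related by the
reflexive–transitive closure of "there is an arc between them". -/
def GraphConnected (n m : ℕ) (tail head : Fin m → Fin n) : Prop :=
  ∀ a b : Fin n, Relation.ReflTransGen
    (fun p q => ∃ j : Fin m, (tail j = p ∧ head j = q) ∨ (tail j = q ∧ head j = p)) a b

lemma incMat_transpose_mulVec (n m : ℕ) (tail head : Fin m → Fin n)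
    (hth : ∀ j : Fin m, tail j ≠ head j) (y : Fin n → ℝ) (j : Fin m) :
    (incMat n m tail head).transpose.mulVec y j = y (tail j) - y (head j) := by
  have h : ∀ i : Fin n, (if i = tail j then (1 : ℝ) else if i = head j then -1 else 0) * y i =
      (if i = tail j then y i else 0) - (if i = head j then y i else 0) := by
    intro i
    by_cases h₁ : i = tail j
    · have h₂ : i ≠ head j := fun h₂ => hth j (h₁.symm.trans h₂)
      simp [h₁, hth j]
    · by_cases h₂ : i = head j <;> simp [h₁, h₂, (hth j).symm]
  simp [Matrix.mulVec, dotProduct, incMat, h, Finset.sum_sub_distrib]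

lemma eq_of_incMat_transpose_mulVec_eq_zero (n m : ℕ) (tail head : Fin m → Fin n)
    (hth : ∀ j : Fin m, tail j ≠ head j) (hconn : GraphConnected n m tail head)
    (y : Fin n → ℝ) (hy : (incMat n m tail head).transpose.mulVec y = 0) (a b : Fin n) :
    y a = y b := by
  have harc : ∀ j, y (tail j) = y (head j) := fun j => by
    have h := congrFun hy j
    rw [incMat_transpose_mulVec n m tail head hth] at h
    exact sub_eq_zero.mp h
  induction hconn a b with
  | refl => rfl
  | tail _ h ih =>
    obtain ⟨j, ⟨rfl, rfl⟩ | ⟨rfl, rfl⟩⟩ := h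
    · exact ih.trans (harc j)
    · exact ih.trans (harc j).symm

/-- The incidence matrix of a connected oriented graph on `n` nodes has rank at least `n - 1`. -/
lemma le_rank_incMat_add_one (n m : ℕ) (tail head : Fin m → Fin n)
    (hth : ∀ j : Fin m, tail j ≠ head j) (hconn : GraphConnected n m tail head) :
    n ≤ (incMat n m tail head).rank + 1 := by
  have hker : LinearMap.ker (incMat n m tail head).transpose.mulVecLin ≤
      Submodule.span ℝ {fun _ : Fin n => (1 : ℝ)} := by
    intro y hy
    rw [LinearMap.mem_ker, Matrix.mulVecLin_apply] at hy
    rw [Submodule.mem_span_singleton]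
    rcases isEmpty_or_nonempty (Fin n) with _ | ⟨⟨a⟩⟩
    · exact ⟨0, Subsingleton.elim _ _⟩
    · refine ⟨y a, funext fun b => ?_⟩
      simpa using eq_of_incMat_transpose_mulVec_eq_zero n m tail head hth hconn y hy a b
  have hdim := (Submodule.finrank_mono hker).trans (finrank_span_le_card _)
  rw [Set.toFinset_card, Fintype.card_unique] at hdim
  have hrn := (incMat n m tail head).transpose.mulVecLin.finrank_range_add_finrank_ker
  rw [← Matrix.rank, Matrix.rank_transpose, Module.finrank_fin_fun] at hrn
  omega

/-- The rows of a cycle matrix of rank at least `m - n + 1` span the cycle space. -/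
lemma range_transpose_eq_ker_incMat (n m : ℕ) (tail head : Fin m → Fin n)
    (hth : ∀ j : Fin m, tail j ≠ head j) (hconn : GraphConnected n m tail head)
    (μ : ℕ) (B : Matrix (Fin μ) (Fin m) ℝ)
    (hB : incMat n m tail head * B.transpose = 0) (hrank : m - n + 1 ≤ B.rank) :
    LinearMap.range B.transpose.mulVecLin = LinearMap.ker (incMat n m tail head).mulVecLin := by
  apply Submodule.eq_of_le_of_finrank_le
  · rintro _ ⟨z, rfl⟩
    rw [LinearMap.mem_ker, Matrix.mulVecLin_apply, Matrix.mulVecLin_apply, Matrix.mulVec_mulVec,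
      hB, Matrix.zero_mulVec]
  · have h := le_rank_incMat_add_one n m tail head hth hconn
    have hrn := (incMat n m tail head).mulVecLin.finrank_range_add_finrank_ker
    rw [← Matrix.rank, Module.finrank_fin_fun] at hrn
    rw [← Matrix.rank, Matrix.rank_transpose]
    omega

/-- Theorem 2: eliminating the flow conservation constraint from the
minimum cost flow problem. `x⋆` minimizes `x ↦ ∑ φ_j(x_j)` over
`{x | 𝔍·x = f, 𝖻 ≤ x ≤ 𝖼}` iff there is `z⋆` with `x⋆ = Bᵀ·z⋆ + xₚ` minimizing the
reduced problem. -/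
theorem min_cost_flow_eliminate_flow_conservation
    (n m : ℕ) (hn : 2 ≤ n) (hm : 1 ≤ m)
    (tail head : Fin m → Fin n) (hth : ∀ j : Fin m, tail j ≠ head j)
    (hconn : GraphConnected n m tail head)
    (μ : ℕ) (hμ : μ = m - n + 1)
    (B : Matrix (Fin μ) (Fin m) ℝ)
    (hB : incMat n m tail head * B.transpose = 0)
    (hrank : B.rank = μ)
    (f : Fin n → ℝ) (xp : Fin m → ℝ)
    (hxp : (incMat n m tail head).mulVec xp = f)
    (φ : Fin m → ℝ → ℝ) (bb cc : Fin m → ℝ)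
    (xstar : Fin m → ℝ) :
    (((incMat n m tail head).mulVec xstar = f ∧
        (∀ j : Fin m, bb j ≤ xstar j ∧ xstar j ≤ cc j)) ∧
      ∀ x : Fin m → ℝ,
        ((incMat n m tail head).mulVec x = f ∧
          (∀ j : Fin m, bb j ≤ x j ∧ x j ≤ cc j)) →
        ∑ j : Fin m, φ j (xstar j) ≤ ∑ j : Fin m, φ j (x j))
    ↔
    (∃ zstar : Fin μ → ℝ,
      xstar = B.transpose.mulVec zstar + xp ∧
      (∀ j : Fin m, bb j ≤ B.transpose.mulVec zstar j + xp j ∧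
        B.transpose.mulVec zstar j + xp j ≤ cc j) ∧
      ∀ z : Fin μ → ℝ,
        (∀ j : Fin m, bb j ≤ B.transpose.mulVec z j + xp j ∧
          B.transpose.mulVec z j + xp j ≤ cc j) →
        ∑ j : Fin m, φ j (B.transpose.mulVec zstar j + xp j) ≤
          ∑ j : Fin m, φ j (B.transpose.mulVec z j + xp j)) := by
  have hrange := range_transpose_eq_ker_incMat n m tail head hth hconn μ B hB
    (hrank.trans hμ).ge
  have hflow : ∀ z, (incMat n m tail head).mulVec (B.transpose.mulVec z + xp) = f := fun z => by
    rw [Matrix.mulVec_add, Matrix.mulVec_mulVec, hB, Matrix.zero_mulVec, zero_add, hxp]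
  have hparam : ∀ x, (incMat n m tail head).mulVec x = f →
      ∃ z, x = B.transpose.mulVec z + xp := fun x hx => by
    have hmem : x - xp ∈ LinearMap.range B.transpose.mulVecLin := by
      rw [hrange, LinearMap.mem_ker, Matrix.mulVecLin_apply, Matrix.mulVec_sub, hx, hxp, sub_self]
    obtain ⟨z, hz⟩ := hmem
    exact ⟨z, sub_eq_iff_eq_add.mp hz.symm⟩
  constructor
  · rintro ⟨⟨hx, hbox⟩, hmin⟩
    obtain ⟨z, rfl⟩ := hparam xstar hx
    exact ⟨z, rfl, hbox, fun w hw => hmin _ ⟨hflow w, hw⟩⟩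
  · rintro ⟨z, rfl, hbox, hmin⟩
    refine ⟨⟨hflow z, hbox⟩, ?_⟩
    rintro x ⟨hx, hxbox⟩
    obtain ⟨w, rfl⟩ := hparam x hx
    exact hmin w hxbox
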